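/- Let A_1, A_2 be n×n quaternion Hermitian matrices and let X be an n×n quaternion Hermitian positive semidefinite matrix of rank r ≥ 1. Then there exist vectors u_1, …, u_r ∈ ℍⁿ such that X = Σ_{i=1}^r u_i u_iᴴ and u_iᴴ A_k u_i = (A_k • X)/r for every i = 1, …, r and k = 1, 2. -/

import Mathlib

open Matrix Quaternion BigOperators

/-- The quadratic form `xᴴ A x` of a quaternion matrix. -/
noncomputable def qform {n : ℕ} (A : Matrix (Fin n) (Fin n) ℍ[ℝ]) (x : Fin n → ℍ[ℝ]) : ℍ[ℝ] :=
  star x ⬝ᵥ A.mulVec x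

/-- The inner product `A • B = Re (tr (Aᴴ B))` of quaternion matrices. -/
noncomputable def qdot {n : ℕ} (A B : Matrix (Fin n) (Fin n) ℍ[ℝ]) : ℝ :=
  (Matrix.trace (Aᴴ * B)).re

/-- A quaternion matrix is Hermitian positive semidefinite:
it is Hermitian and `xᴴ X x ≥ 0` for all `x`. -/
def qPSD {n : ℕ} (X : Matrix (Fin n) (Fin n) ℍ[ℝ]) : Prop :=
  X.IsHermitian ∧ ∀ x : Fin n → ℍ[ℝ], 0 ≤ (star x ⬝ᵥ X.mulVec x).re

/-- `X` can be written as a sum of `r` quaternion rank-one outer products. -/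
def qDecomp {n : ℕ} (X : Matrix (Fin n) (Fin n) ℍ[ℝ]) (r : ℕ) : Prop :=
  ∃ v : Fin r → (Fin n → ℍ[ℝ]), X = ∑ i, vecMulVec (v i) (star (v i))

/-- `X` has rank `r`: `r` is the least number of rank-one terms summing to `X`. -/
def qRank {n : ℕ} (X : Matrix (Fin n) (Fin n) ℍ[ℝ]) (r : ℕ) : Prop :=
  qDecomp X r ∧ ∀ s : ℕ, qDecomp X s → r ≤ s

section Equalization

variable {V M E : Type*} [AddCommGroup M] [Module ℝ M] [AddCommGroup E] [Module ℝ E]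

/-- If all values but one agree, averaging moves on pairs make all values equal to the mean. -/
lemma exists_equalized_of_const (G : V → M) (L : M →ₗ[ℝ] E)
    (hpair : ∀ (u v : V) (t : ℝ), 0 ≤ t → t ≤ 1 → ∃ u' v' : V,
      G u' + G v' = G u + G v ∧ L (G u') = (1 - t) • L (G u) + t • L (G v))
    (s : ℕ) (u : Fin s → V) (v : V) (m : E) (hm : ∀ i, L (G (u i)) = m) :
    ∃ w : Fin (s + 1) → V, ∑ i, G (w i) = ∑ i, G (u i) + G v ∧
      ∀ i, L (G (w i)) = ((s : ℝ) + 1)⁻¹ • ((s : ℝ) • m + L (G v)) := by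
  induction s generalizing v with
  | zero => exact ⟨fun _ => v, by simp, by simp⟩
  | succ s ih =>
    obtain ⟨a, b, hG, hL⟩ := hpair (u 0) v ((s + 2 : ℝ)⁻¹) (by positivity)
      (inv_le_one_of_one_le₀ (by linarith [(Nat.cast_nonneg s : (0 : ℝ) ≤ s)]))
    have hLb : L (G b) = m + L (G v) - L (G a) := by
      have := congrArg L hG
      rw [map_add, map_add, hm] at this
      rw [← this]; abel
    obtain ⟨w, hw, hwL⟩ := ih (fun i => u i.succ) b (fun i => hm _)
    refine ⟨Fin.cons a w, ?_, ?_⟩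
    · rw [Fin.sum_univ_succ, Fin.sum_univ_succ (fun i => G (u i))]
      simp only [Fin.cons_zero, Fin.cons_succ, hw]
      calc _ = (G a + G b) + ∑ i : Fin s, G (u i.succ) := by abel
        _ = _ := by rw [hG]; abel
    · rw [hm] at hL
      refine Fin.cases ?_ (fun i => ?_)
      · rw [Fin.cons_zero, hL]
        push_cast
        match_scalars <;> field_simp <;> ring
      · rw [Fin.cons_succ, hwL, hLb, hL]
        push_cast
        match_scalars <;> field_simp <;> ring

/-- Averaging moves on pairs make all values of a finite family equal to the mean. -/
lemma exists_equalized (G : V → M) (L : M →ₗ[ℝ] E)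
    (hpair : ∀ (u v : V) (t : ℝ), 0 ≤ t → t ≤ 1 → ∃ u' v' : V,
      G u' + G v' = G u + G v ∧ L (G u') = (1 - t) • L (G u) + t • L (G v))
    (r : ℕ) (u : Fin r → V) :
    ∃ w : Fin r → V, ∑ i, G (w i) = ∑ i, G (u i) ∧
      ∀ i, L (G (w i)) = (r : ℝ)⁻¹ • L (∑ i, G (u i)) := by
  induction r with
  | zero => exact ⟨u, rfl, fun i => i.elim0⟩
  | succ r ih =>
    obtain ⟨w, hw, hwL⟩ := ih (fun i => u i.succ)
    obtain ⟨z, hz, hzL⟩ := exists_equalized_of_const G L hpair r w (u 0) _ hwL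
    refine ⟨z, by rw [hz, hw, Fin.sum_univ_succ (fun i => G (u i)), add_comm], fun i => ?_⟩
    rw [hzL, Fin.sum_univ_succ (fun i => G (u i)), map_add, Nat.cast_succ]
    rcases Nat.eq_zero_or_pos r with rfl | hr
    · simp
    · have : (r : ℝ) ≠ 0 := by positivity
      rw [smul_inv_smul₀ this, add_comm (L (G (u 0)))]

end Equalization

lemma Quaternion.re_mul_comm (a b : ℍ[ℝ]) : (a * b).re = (b * a).re := by
  simp only [Quaternion.re_mul]; ring

lemma Quaternion.re_sum {ι : Type*} (s : Finset ι) (f : ι → ℍ[ℝ]) :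
    (∑ i ∈ s, f i).re = ∑ i ∈ s, (f i).re :=
  map_sum (⟨⟨fun q : ℍ[ℝ] => q.re, rfl⟩, fun _ _ => rfl⟩ : ℍ[ℝ] →+ ℝ) f s

/-- `qdot A` as a real linear functional. -/
noncomputable def qdotLinear {n : ℕ} (A : Matrix (Fin n) (Fin n) ℍ[ℝ]) :
    Matrix (Fin n) (Fin n) ℍ[ℝ] →ₗ[ℝ] ℝ where
  toFun := qdot A
  map_add' B C := by simp [qdot, Matrix.mul_add]
  map_smul' c B := by simp [qdot]

lemma qdot_vecMulVec {n : ℕ} {A : Matrix (Fin n) (Fin n) ℍ[ℝ]} (hA : A.IsHermitian)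
    (u : Fin n → ℍ[ℝ]) : qdot A (vecMulVec u (star u)) = (qform A u).re := by
  rw [qdot, hA.eq, qform, mul_vecMulVec, trace, dotProduct, Quaternion.re_sum, Quaternion.re_sum]
  exact Finset.sum_congr rfl fun i _ => Quaternion.re_mul_comm _ _

lemma qform_eq_coe_re {n : ℕ} {A : Matrix (Fin n) (Fin n) ℍ[ℝ]} (hA : A.IsHermitian)
    (u : Fin n → ℍ[ℝ]) : qform A u = ((qform A u).re : ℍ[ℝ]) := by
  have h : star (qform A u) = qform A u := by
    rw [qform, ← star_dotProduct, star_mulVec, hA.eq, ← dotProduct_mulVec]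
  exact Quaternion.star_eq_self.1 h

/-- The Hermitian cross term `(v w) uᴴ + u (v w)ᴴ`, real linear in the quaternion `w`. -/
noncomputable def crossTerm {n : ℕ} (u v : Fin n → ℍ[ℝ]) :
    ℍ[ℝ] →ₗ[ℝ] Matrix (Fin n) (Fin n) ℍ[ℝ] where
  toFun w := vecMulVec (fun i => v i * w) (star u) + vecMulVec u (star fun i => v i * w)
  map_add' w z := by
    ext1 i j
    simp only [Matrix.add_apply, vecMulVec_apply, Pi.star_apply, mul_add, add_mul, star_add]
    abel
  map_smul' c w := by
    ext1 i j
    simp [vecMulVec_apply, Pi.star_apply]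

lemma exists_norm_one_crossTerm_eq_zero {n : ℕ}
    (L : Matrix (Fin n) (Fin n) ℍ[ℝ] →ₗ[ℝ] ℝ × ℝ) (u v : Fin n → ℍ[ℝ]) :
    ∃ w : ℍ[ℝ], w * star w = 1 ∧ L (crossTerm u v w) = 0 := by
  have hker : LinearMap.ker (L ∘ₗ crossTerm u v) ≠ ⊥ :=
    LinearMap.ker_ne_bot_of_finrank_lt (by
      rw [Quaternion.finrank_eq_four]; simp)
  obtain ⟨z, hz, hz0⟩ := Submodule.exists_mem_ne_zero_of_ne_bot hker
  have hnorm : ‖z‖ ≠ 0 := norm_ne_zero_iff.2 hz0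
  refine ⟨‖z‖⁻¹ • z, ?_, ?_⟩
  · rw [Quaternion.self_mul_star, Quaternion.normSq_eq_norm_mul_self, norm_smul, norm_inv,
      norm_norm, inv_mul_cancel₀ hnorm]
    simp
  · have : L (crossTerm u v z) = 0 := hz
    rw [map_smul, map_smul, this, smul_zero]

/-- A unitary recombination of two vectors moves the first value along the segment joining the
two values. -/
lemma exists_pair_recombination {n : ℕ} (L : Matrix (Fin n) (Fin n) ℍ[ℝ] →ₗ[ℝ] ℝ × ℝ)
    (u v : Fin n → ℍ[ℝ]) (t : ℝ) (ht₀ : 0 ≤ t) (ht₁ : t ≤ 1) :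
    ∃ u' v' : Fin n → ℍ[ℝ],
      vecMulVec u' (star u') + vecMulVec v' (star v') =
        vecMulVec u (star u) + vecMulVec v (star v) ∧
      L (vecMulVec u' (star u')) =
        (1 - t) • L (vecMulVec u (star u)) + t • L (vecMulVec v (star v)) := by
  obtain ⟨w, hw, hL⟩ := exists_norm_one_crossTerm_eq_zero L u v
  set z : Fin n → ℍ[ℝ] := fun i => v i * w with hz
  have hzz : vecMulVec z (star z) = vecMulVec v (star v) := by
    ext1 i j
    simp only [vecMulVec_apply, hz, Pi.star_apply, star_mul]
    rw [mul_assoc, ← mul_assoc w, hw, one_mul]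
  have hcomb (c s : ℝ) : vecMulVec (c • u + s • z) (star (c • u + s • z)) =
      (c * c) • vecMulVec u (star u) + (s * s) • vecMulVec z (star z) +
        (c * s) • crossTerm u v w := by
    change _ = _ + (c * s) • (vecMulVec z (star u) + vecMulVec u (star z))
    have hstar (a : ℝ) (x : Fin n → ℍ[ℝ]) : star (a • x) = a • star x :=
      funext fun i => Quaternion.star_smul a (x i)
    simp only [star_add, hstar, add_vecMulVec, vecMulVec_add, smul_vecMulVec, vecMulVec_smul]
    module
  have hc : √(1 - t) * √(1 - t) = 1 - t := Real.mul_self_sqrt (by linarith)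
  have hs : √t * √t = t := Real.mul_self_sqrt ht₀
  refine ⟨√(1 - t) • u + √t • z, (-√t) • u + √(1 - t) • z, ?_, ?_⟩
  · rw [hcomb, hcomb, neg_mul_neg, hc, hs, hzz]
    module
  · rw [hcomb, hc, hs, hzz]
    simp only [map_add, map_smul, hL, smul_zero, add_zero]

/-- Quaternion Hermitian matrix rank-one decomposition with the equal inner
product property for two matrices. -/
theorem quaternion_rank_one_decomposition_two {n r : ℕ} (hr : 1 ≤ r)
    (A₁ A₂ : Matrix (Fin n) (Fin n) ℍ[ℝ])
    (h₁ : A₁.IsHermitian) (h₂ : A₂.IsHermitian)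
    (X : Matrix (Fin n) (Fin n) ℍ[ℝ]) (hX : qPSD X) (hrank : qRank X r) :
    ∃ u : Fin r → (Fin n → ℍ[ℝ]),
      X = ∑ i, vecMulVec (u i) (star (u i)) ∧
      ∀ i : Fin r,
        qform A₁ (u i) = ((qdot A₁ X / r : ℝ) : ℍ[ℝ]) ∧
        qform A₂ (u i) = ((qdot A₂ X / r : ℝ) : ℍ[ℝ]) := by
  obtain ⟨v, rfl⟩ := hrank.1
  obtain ⟨w, hw, hwL⟩ := exists_equalized (fun x => vecMulVec x (star x))
    ((qdotLinear A₁).prod (qdotLinear A₂)) (exists_pair_recombination _) r v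
  refine ⟨w, hw.symm, fun i => ?_⟩
  have h := hwL i
  rw [qform_eq_coe_re h₁, qform_eq_coe_re h₂, ← qdot_vecMulVec h₁, ← qdot_vecMulVec h₂,
    div_eq_inv_mul, div_eq_inv_mul]
  exact ⟨congrArg _ (congrArg Prod.fst h), congrArg _ (congrArg Prod.snd h)⟩
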